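/- arXiv:1109.1391 — 6 statements merged into one kernel-verified Lean document; each statement's English description precedes it below -/
import Mathlib

section
/- Let R be a Noetherian ring and let a₁,...,aₙ ∈ R be elements such that R has a prime ideal of height n lying minimally over the ideal (a₁,...,aₙ). Then a₁,...,aₙ are algebraically independent over R, i.e., there is no nonzero polynomial f ∈ R[x₁,...,xₙ] with f(a₁,...,aₙ) = 0 whose trailing coefficient with respect to some monomial ordering equals 1. -/
/-- A *monomial ordering* on the monomials of `R[x_i : i ∈ σ]`, identified with
exponent vectors `σ →₀ ℕ`: a total order compatible with multiplication for
which `1` (i.e. the exponent `0`) is smallest. -/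
structure MonomialOrdering (σ : Type*) where
  le : (σ →₀ ℕ) → (σ →₀ ℕ) → Prop
  le_refl : ∀ a, le a a
  le_trans : ∀ {a b c}, le a b → le b c → le a c
  le_antisymm : ∀ {a b}, le a b → le b a → a = b
  le_total : ∀ a b, le a b ∨ le b a
  zero_le : ∀ a, le 0 a
  add_le_add_left : ∀ {b c} (a), le b c → le (a + b) (a + c)

/-- A polynomial is *submonic* with respect to a monomial ordering if its least
monomial with nonzero coefficient has coefficient `1`. -/
def MvPolynomial.SubmonicWrt {σ R : Type*} [CommRing R] (mo : MonomialOrdering σ)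
    (f : MvPolynomial σ R) : Prop :=
  ∃ m ∈ f.support, MvPolynomial.coeff m f = 1 ∧ ∀ m' ∈ f.support, mo.le m m'

/-- Over `ℤ`, finitely many vectors of an additive semigroup that avoids `0` lie in a common
open half-space. -/
theorem exists_linearMap_pos_of_mem_addSubsemigroup {ι κ : Type*} (C : AddSubsemigroup (ι → ℤ))
    (hC : 0 ∉ C) (s : Finset κ) (v : κ → ι → ℤ) (hv : ∀ k ∈ s, v k ∈ C) :
    ∃ φ : (ι → ℤ) →ₗ[ℤ] ℤ, ∀ k ∈ s, 0 < φ (v k) := by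
  classical
  have smul_mem : ∀ (c : ℤ) (x : ι → ℤ), 0 < c → x ∈ C → c • x ∈ C := by
    intro c x hc hx
    lift c to ℕ using hc.le
    induction c, (show 1 ≤ c by lia) using Nat.le_induction with
    | base => simpa using hx
    | succ c hle ih =>
      rw [Nat.cast_succ, add_smul, one_smul]
      exact C.add_mem (ih (by lia)) hx
  induction s using Finset.induction_on generalizing v with
  | empty => exact ⟨0, by simp⟩
  | insert l s _ ih =>
    have hl : v l ∈ C := hv l (Finset.mem_insert_self l s)
    have hs : ∀ k ∈ s, v k ∈ C := fun k hk => hv k (Finset.mem_insert_of_mem hk)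
    obtain ⟨φ, hφ⟩ := ih v hs
    rcases lt_or_ge 0 (φ (v l)) with hpos | hnonpos
    · exact ⟨φ, Finset.forall_mem_insert _ _ _ |>.2 ⟨hpos, hφ⟩⟩
    -- a functional vanishing at `v l` and positive on the other vectors
    obtain ⟨χ, hχl, hχ⟩ : ∃ χ : (ι → ℤ) →ₗ[ℤ] ℤ, χ (v l) = 0 ∧ ∀ k ∈ s, 0 < χ (v k) := by
      rcases hnonpos.eq_or_lt with hzero | hneg
      · exact ⟨φ, hzero, hφ⟩
      obtain ⟨ψ, hψ⟩ := ih (fun k => (-φ (v l)) • v k + φ (v k) • v l) fun k hk =>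
        C.add_mem (smul_mem _ _ (by linarith) (hs k hk)) (smul_mem _ _ (hφ k hk) hl)
      refine ⟨(-φ (v l)) • ψ + ψ (v l) • φ, ?_, fun k hk => ?_⟩
      · simp only [LinearMap.add_apply, LinearMap.smul_apply, smul_eq_mul]
        ring
      · have := hψ k hk
        simp only [map_add, map_smul, LinearMap.add_apply, LinearMap.smul_apply,
          smul_eq_mul] at this ⊢
        linarith
    obtain ⟨θ, hθ⟩ : ∃ θ : (ι → ℤ) →ₗ[ℤ] ℤ, 0 < θ (v l) := by
      have hne : v l ≠ 0 := fun h => hC (h ▸ hl)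
      obtain ⟨i, hi⟩ := Function.ne_iff.1 hne
      rcases lt_or_gt_of_ne hi with h | h
      · exact ⟨-LinearMap.proj i, by simpa using h⟩
      · exact ⟨LinearMap.proj i, by simpa using h⟩
    set N : ℤ := 1 + ∑ k ∈ s, |θ (v k)| with hN
    refine ⟨N • χ + θ, Finset.forall_mem_insert _ _ _ |>.2 ⟨by simpa [hχl] using hθ, ?_⟩⟩
    intro k hk
    have h₁ : |θ (v k)| ≤ ∑ k ∈ s, |θ (v k)| :=
      Finset.single_le_sum (f := fun k => |θ (v k)|) (fun _ _ => abs_nonneg _) hk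
    have h₂ := neg_abs_le (θ (v k))
    have h₃ : 0 < χ (v k) := hχ k hk
    have h₄ := abs_nonneg (θ (v k))
    simp only [LinearMap.add_apply, LinearMap.smul_apply, smul_eq_mul]
    nlinarith

namespace MonomialOrdering

variable {σ : Type*} (mo : MonomialOrdering σ)

/-- The semigroup of differences `q - p` of exponents with `p` strictly below `q`. -/
def positiveDifferences : AddSubsemigroup (σ → ℤ) where
  carrier := {x | ∃ p q : σ →₀ ℕ, mo.le p q ∧ p ≠ q ∧ x = fun i => (q i : ℤ) - p i}
  add_mem' := by
    rintro _ _ ⟨p, q, hpq, hne, rfl⟩ ⟨p', q', hpq', hne', rfl⟩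
    have h₁ : mo.le (p + p') (p + q') := mo.add_le_add_left p hpq'
    have h₂ : mo.le (p + q') (q + q') := by
      simpa only [add_comm _ q'] using mo.add_le_add_left q' hpq
    refine ⟨p + p', q + q', mo.le_trans h₁ h₂, fun h => hne ?_, ?_⟩
    · exact add_right_cancel (mo.le_antisymm h₂ (h ▸ h₁))
    · ext i
      simp only [Pi.add_apply, Finsupp.add_apply]
      push_cast
      ring

theorem zero_notMem_positiveDifferences : (0 : σ → ℤ) ∉ mo.positiveDifferences := by
  rintro ⟨p, q, -, hne, h⟩
  refine hne (Finsupp.ext fun i => ?_)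
  have := congrFun h i
  simp only [Pi.zero_apply] at this
  lia

/-- On a finite set of exponents with least element `m`, a monomial ordering is refined by
positive integral weights for which `m` has strictly smallest weight. -/
theorem exists_weights [Fintype σ] (m : σ →₀ ℕ) (s : Finset (σ →₀ ℕ)) (hs : ∀ d ∈ s, mo.le m d) :
    ∃ w : σ → ℕ, (∀ i, 0 < w i) ∧ ∀ d ∈ s, d ≠ m → ∑ i, w i * m i < ∑ i, w i * d i := by
  classical
  let v : σ ⊕ (σ →₀ ℕ) → σ → ℤ :=
    Sum.elim (fun i => Pi.single i 1) (fun d i => (d i : ℤ) - m i)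
  obtain ⟨φ, hφ⟩ := exists_linearMap_pos_of_mem_addSubsemigroup mo.positiveDifferences
    mo.zero_notMem_positiveDifferences (Finset.univ.disjSum (s.erase m)) v (by
      rintro (i | d) h
      · refine ⟨0, Finsupp.single i 1, mo.zero_le _, by simp [eq_comm], ?_⟩
        ext k
        simp [v, Finsupp.single_apply, Pi.single_apply, eq_comm]
      · simp only [Finset.inr_mem_disjSum, Finset.mem_erase] at h
        exact ⟨m, d, hs d h.2, h.1.symm, rfl⟩)
  have hw : ∀ i, 0 < φ (Pi.single i 1) := fun i => hφ (Sum.inl i) (by simp)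
  refine ⟨fun i => (φ (Pi.single i 1)).toNat, fun i => by simpa using hw i, fun d hd hne => ?_⟩
  have h := hφ (Sum.inr d) (by simp [hd, hne])
  rw [LinearMap.pi_apply_eq_sum_univ] at h
  zify
  rw [← sub_pos, ← Finset.sum_sub_distrib]
  refine h.trans_eq (Finset.sum_congr rfl fun i _ => ?_)
  have hi : (fun j => if i = j then (1 : ℤ) else 0) = Pi.single i 1 := by
    ext k
    simp [Pi.single_apply, eq_comm]
  rw [hi, Int.toNat_of_nonneg (hw i).le]
  simp only [v, Sum.elim_inr, smul_eq_mul]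
  ring

end MonomialOrdering

/-- A prime `q ⊆ P` over which the elements `a i` lie on the weighted monomial curve
`a i ^ w j = a j ^ w i` contains `a j ∈ P`, if the `a i` satisfy a relation with a term of
coefficient `1` and strictly smallest weight. -/
theorem mem_of_eval_eq_zero_of_weights {R ι : Type*} [CommRing R] [Fintype ι] (a : ι → R)
    (w : ι → ℕ) (j : ι) (hwj : 0 < w j) {P q : Ideal R} [P.IsPrime] [q.IsPrime] (hqP : q ≤ P)
    (hj : a j ∈ P) (hcurve : ∀ i, a i ^ w j - a j ^ w i ∈ q)
    (f : MvPolynomial ι R) (hf : MvPolynomial.eval a f = 0) (m : ι →₀ ℕ)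
    (hm : m ∈ f.support) (hm₁ : f.coeff m = 1)
    (hlt : ∀ d ∈ f.support, d ≠ m → ∑ i, w i * m i < ∑ i, w i * d i) : a j ∈ q := by
  classical
  by_contra hjq
  let K := FractionRing (R ⧸ q)
  have hker : ∀ r : R, algebraMap R K r = 0 ↔ r ∈ q := by
    intro r
    rw [IsScalarTower.algebraMap_apply R (R ⧸ q) K,
      FaithfulSMul.algebraMap_eq_zero_iff, Ideal.Quotient.algebraMap_eq,
      Ideal.Quotient.eq_zero_iff_mem]
  set x : ι → K := fun i => algebraMap R K (a i) with hx
  have hxj : x j ≠ 0 := fun h => hjq ((hker _).1 h)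
  have hxpow : ∀ i, x i ^ w j = x j ^ w i := by
    intro i
    rw [← sub_eq_zero]
    simpa [hx] using (hker _).2 (hcurve i)
  have hxne : ∀ i, x i ≠ 0 := fun i h => by
    have := hxpow i
    rw [h, zero_pow hwj.ne'] at this
    exact pow_ne_zero _ hxj this.symm
  have hmon : ∀ d : ι →₀ ℕ, (∏ i, x i ^ d i) ^ w j = x j ^ ∑ i, w i * d i := by
    intro d
    rw [← Finset.prod_pow, ← Finset.prod_pow_eq_pow_sum]
    refine Finset.prod_congr rfl fun i _ => ?_
    rw [← pow_mul, mul_comm, pow_mul, hxpow, pow_mul]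
  have hmne : ∏ i, x i ^ m i ≠ 0 := Finset.prod_ne_zero_iff.2 fun i _ => pow_ne_zero _ (hxne i)
  let z : (ι →₀ ℕ) → K := fun d => (∏ i, x i ^ d i) / ∏ i, x i ^ m i
  have hz : ∀ d ∈ f.support.erase m, ∃ e, 0 < e ∧ z d ^ w j = algebraMap R K (a j ^ e) := by
    intro d hd
    have h := hlt d (Finset.mem_of_mem_erase hd) (Finset.ne_of_mem_erase hd)
    refine ⟨_, Nat.sub_pos_of_lt h, ?_⟩
    rw [div_pow, hmon, hmon, map_pow, div_eq_iff (pow_ne_zero _ hxj), ← pow_add,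
      Nat.sub_add_cancel h.le]
  have hzint : ∀ d ∈ f.support.erase m, z d ∈ integralClosure R K := by
    intro d hd
    obtain ⟨e, -, he⟩ := hz d hd
    exact IsIntegral.of_pow hwj (he ▸ isIntegral_algebraMap)
  obtain ⟨Q, -, hQ, hQP⟩ := Ideal.exists_ideal_over_prime_of_isIntegral
    (S := integralClosure R K) P ⊥ (fun r hr => hqP ((hker r).1 (by
      simpa using congrArg Subtype.val (show algebraMap R (integralClosure R K) r = 0 from hr))))
  have hzQ : ∀ d (hd : d ∈ f.support.erase m),
      (⟨z d, hzint d hd⟩ : integralClosure R K) ∈ Q := by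
    intro d hd
    obtain ⟨e, he, hze⟩ := hz d hd
    refine hQ.mem_of_pow_mem (w j) ?_
    have : (⟨z d, hzint d hd⟩ : integralClosure R K) ^ w j = algebraMap R _ (a j ^ e) :=
      Subtype.ext hze
    rw [this, ← Ideal.mem_comap, hQP]
    exact Ideal.pow_mem_of_mem P hj e he
  have hsum : 1 + ∑ d ∈ f.support.erase m, algebraMap R K (f.coeff d) * z d = 0 := by
    have h : algebraMap R K (MvPolynomial.eval a f) = 0 := by rw [hf, map_zero]
    rw [MvPolynomial.eval_eq', ← Finset.add_sum_erase _ _ hm, hm₁, one_mul] at h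
    simp only [map_add, map_sum, map_mul, map_prod, map_pow] at h
    have h' := congrArg (· / ∏ i, x i ^ m i) h
    simp only [add_div, Finset.sum_div, zero_div, mul_div_assoc] at h'
    rwa [div_self hmne] at h'
  refine hQ.ne_top ((Ideal.eq_top_iff_one Q).2 ?_)
  have hone : (1 : integralClosure R K) = -∑ d ∈ (f.support.erase m).attach,
      algebraMap R (integralClosure R K) (f.coeff d) * ⟨z d, hzint d d.2⟩ := by
    rw [← add_eq_zero_iff_eq_neg]
    apply Subtype.ext
    rw [← Finset.sum_attach] at hsum
    simpa using hsum
  rw [hone]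
  exact Q.neg_mem (Q.sum_mem fun d _ => Q.mul_mem_left _ (hzQ d d.2))

/-- If `R` is Noetherian and there is a prime of height `n` lying minimally over
`(a₁, …, aₙ)`, then `a₁, …, aₙ` are algebraically independent over `R`: they
satisfy no submonic polynomial relation with respect to any monomial ordering. -/
theorem algebraically_independent_of_height_minimal {R : Type*} [CommRing R]
    [IsNoetherianRing R] {n : ℕ} (a : Fin n → R) (P : Ideal R) (hP : P.IsPrime)
    (hmin : P ∈ (Ideal.span (Set.range a)).minimalPrimes)
    (hht : Order.height (⟨P, hP⟩ : PrimeSpectrum R) = n) :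
    ¬ ∃ (mo : MonomialOrdering (Fin n)) (f : MvPolynomial (Fin n) R),
        f.SubmonicWrt mo ∧ MvPolynomial.eval a f = 0 := by
  rintro ⟨mo, f, ⟨m, hm, hm₁, hle⟩, hf⟩
  obtain ⟨w, hw, hlt⟩ := mo.exists_weights m f.support hle
  have haP : ∀ i, a i ∈ P := fun i => hmin.1.2 (Ideal.subset_span ⟨i, rfl⟩)
  cases n with
  | zero =>
    have : (1 : R) = 0 := by
      rw [← hf, MvPolynomial.eval_eq', Finset.sum_eq_single_of_mem m hm
        fun d _ hd => absurd (Subsingleton.elim d m) hd, hm₁]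
      simp
    exact hP.ne_top ((Ideal.eq_top_iff_one P).2 (this ▸ P.zero_mem))
  | succ k =>
    let b : Fin k → R := fun i =>
      a i.castSucc ^ w (Fin.last k) - a (Fin.last k) ^ w i.castSucc
    have hbP : Ideal.span (Set.range b) ≤ P := by
      rw [Ideal.span_le]
      rintro _ ⟨i, rfl⟩
      exact P.sub_mem (Ideal.pow_mem_of_mem P (haP _) _ (hw _))
        (Ideal.pow_mem_of_mem P (haP _) _ (hw _))
    have hbmin : P ∈ (Ideal.span (Set.range b)).minimalPrimes := by
      refine ⟨⟨hP, hbP⟩, ?_⟩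
      rintro q ⟨hq, hbq⟩ hqP
      have hcurve : ∀ i, a i ^ w (Fin.last k) - a (Fin.last k) ^ w i ∈ q := by
        refine Fin.lastCases (by simp) fun i => hbq (Ideal.subset_span ⟨i, rfl⟩)
      have hlast : a (Fin.last k) ∈ q := mem_of_eval_eq_zero_of_weights a w (Fin.last k) (hw _)
        hqP (haP _) hcurve f hf m hm hm₁ hlt
      refine hmin.2 ⟨hq, Ideal.span_le.2 ?_⟩ hqP
      rintro _ ⟨i, rfl⟩
      refine hq.mem_of_pow_mem (w (Fin.last k)) ?_
      exact (Submodule.sub_mem_iff_left q (Ideal.pow_mem_of_mem q hlast _ (hw i))).1 (hcurve i)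
    have hle' : P.height ≤ k := by
      refine (Ideal.height_le_card_of_mem_minimalPrimes_span (Set.finite_range b) hbmin).trans ?_
      rw [← Set.image_univ]
      exact_mod_cast (Set.ncard_image_le Set.finite_univ).trans (by simp)
    rw [← PrimeSpectrum.height_eq_orderHeight] at hht
    have : ((k + 1 : ℕ) : ℕ∞) ≤ k := hht ▸ hle'
    exact absurd (Nat.cast_le.1 this) (by lia)
end

section
/- A Noetherian ring R is a Jacobson ring if and only if for every prime ideal P of R with dim(R/P) = 1 there exist infinitely many maximal ideals of R containing P. -/
/-- In a Noetherian domain, if `f` lies in every nonzero prime ideal, then every nonzero prime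
ideal is minimal over `f`. -/
theorem Ideal.mem_minimalPrimes_span_singleton_of_forall_mem {A : Type*} [CommRing A] [IsDomain A]
    [IsNoetherianRing A] {f : A} (hf0 : f ≠ 0)
    (hf : ∀ q : Ideal A, q.IsPrime → q ≠ ⊥ → f ∈ q) {Q : Ideal A} (hQ : Q.IsPrime) (hQ0 : Q ≠ ⊥) :
    Q ∈ (Ideal.span {f}).minimalPrimes := by
  have hfQ : Ideal.span {f} ≤ Q := (Ideal.span_singleton_le_iff_mem Q).2 (hf Q hQ hQ0)
  suffices h : ∃ p ∈ (Ideal.span {f}).minimalPrimes, Q ≤ p by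
    obtain ⟨p, hp, hQp⟩ := h
    exact le_antisymm hQp (hp.2 ⟨hQ, hfQ⟩ hQp) ▸ hp
  by_contra hnot
  obtain ⟨x, hxQ, hx⟩ := Set.not_subset.1 <| mt (Ideal.subset_union_prime_finite (f := id)
    ((Ideal.span {f}).finite_minimalPrimes_of_isNoetherianRing A) ⊥ ⊥
    (fun p hp _ _ ↦ hp.1.1)).1 hnot
  have hx' : ∀ p ∈ (Ideal.span {f}).minimalPrimes, x ∉ p := fun p hp hxp ↦
    hx (Set.mem_biUnion hp hxp)
  have hx0 : x ≠ 0 := by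
    rintro rfl
    obtain ⟨p, hp, -⟩ := Ideal.exists_minimalPrimes_le hfQ
    exact hx' p hp p.zero_mem
  obtain ⟨q, hq, -⟩ := Ideal.exists_minimalPrimes_le ((Ideal.span_singleton_le_iff_mem Q).2 hxQ)
  have hqprime : q.IsPrime := hq.1.1
  have hxq : x ∈ q := (Ideal.span_singleton_le_iff_mem q).1 hq.1.2
  have hq0 : q ≠ ⊥ := fun h ↦ hx0 (by simpa [h] using hxq)
  obtain ⟨p, hp, hpq⟩ :=
    Ideal.exists_minimalPrimes_le ((Ideal.span_singleton_le_iff_mem q).2 (hf q hqprime hq0))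
  have hpprime : p.IsPrime := hp.1.1
  have hp0 : p ≠ ⊥ := fun h ↦ hf0
    (by simpa [h] using (Ideal.span_singleton_le_iff_mem p).1 hp.1.2)
  have hqht := Ideal.height_le_one_of_isPrincipal_of_mem_minimalPrimes _ q hq
  have hpq' : p < q := lt_of_le_of_ne hpq fun h ↦ hx' p hp (h ▸ hxq)
  have hlt := (Ideal.height_strict_mono_of_isPrime_of_isPrime hpq').trans_le hqht
  exact hp0 (Ideal.height_eq_zero_iff_eq_bot.1 (Order.lt_one_iff.1 hlt))

/-- A Noetherian domain that is not a field and has a nonzero element lying in every nonzero prime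
ideal is one-dimensional. -/
theorem ringKrullDim_eq_one_of_forall_mem {A : Type*} [CommRing A] [IsDomain A]
    [IsNoetherianRing A] (hA : ¬ IsField A) {f : A} (hf0 : f ≠ 0)
    (hf : ∀ q : Ideal A, q.IsPrime → q ≠ ⊥ → f ∈ q) : ringKrullDim A = 1 := by
  have hle : Ring.KrullDimLE 1 A := .mk₁' fun Q hQ0 hQ ↦ by
    obtain ⟨m, hm, hQm⟩ := Q.exists_le_maximal hQ.ne_top
    have hmin := Ideal.mem_minimalPrimes_span_singleton_of_forall_mem hf0 hf hm.isPrime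
      (ne_bot_of_le_ne_bot hQ0 hQm)
    have hmQ := hmin.2 ⟨hQ, (Ideal.span_singleton_le_iff_mem Q).2 (hf Q hQ hQ0)⟩ hQm
    exact le_antisymm hQm hmQ ▸ hm
  refine le_antisymm (by simpa using Ring.krullDimLE_iff.1 hle) ?_
  obtain ⟨m, hm⟩ := Ideal.exists_maximal A
  have hm0 : m ≠ ⊥ := Ring.ne_bot_of_isMaximal_of_not_isField hm hA
  have hht : 1 ≤ m.height :=
    Order.one_le_iff_ne_zero.2 fun h ↦ hm0 (Ideal.height_eq_zero_iff_eq_bot.1 h)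
  exact le_trans (by exact_mod_cast hht) (Ideal.height_le_ringKrullDim_of_ne_top hm.ne_top)

/-- In a Jacobson ring, a prime ideal contained in only finitely many maximal ideals is maximal. -/
theorem Ideal.IsPrime.isMaximal_of_finite_maximals {R : Type*} [CommRing R] [IsJacobsonRing R]
    {P : Ideal R} (hP : P.IsPrime) (hfin : {m : Ideal R | P ≤ m ∧ m.IsMaximal}.Finite) :
    P.IsMaximal := by
  have hinf : hfin.toFinset.inf id ≤ P := by
    rw [Finset.inf_id_eq_sInf, hfin.coe_toFinset]
    exact (isJacobsonRing_iff_prime_eq.1 inferInstance P hP).le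
  obtain ⟨m, hm, hmP⟩ := hP.inf_le'.1 hinf
  obtain ⟨hPm, hmax⟩ := hfin.mem_toFinset.1 hm
  exact le_antisymm hmP hPm ▸ hmax

/-- A Noetherian ring `R` is Jacobson iff every prime `P` with `dim (R/P) = 1`
is contained in infinitely many maximal ideals. -/
theorem isJacobsonRing_iff_infinite_maximals {R : Type*} [CommRing R]
    [IsNoetherianRing R] :
    IsJacobsonRing R ↔
      ∀ P : Ideal R, P.IsPrime → ringKrullDim (R ⧸ P) = 1 →
        {m : Ideal R | P ≤ m ∧ m.IsMaximal}.Infinite := by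
  refine ⟨fun _ P hP hdim hfin ↦ ?_, fun h ↦ isJacobsonRing_iff_prime_eq.2 ?_⟩
  · have hmax := hP.isMaximal_of_finite_maximals hfin
    rw [ringKrullDim_eq_zero_of_isField ((Ideal.Quotient.maximal_ideal_iff_isField_quotient P).1
      hmax)] at hdim
    exact zero_ne_one hdim
  intro P
  refine IsNoetherian.induction (P := fun P : Ideal R ↦ P.IsPrime → P.jacobson = P)
    (fun (P : Ideal R) ih hP ↦ ?_) P
  by_contra hne
  obtain ⟨f, hfjac, hfP⟩ := SetLike.exists_of_lt (lt_of_le_of_ne Ideal.le_jacobson (Ne.symm hne))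
  have hPmax : ¬ P.IsMaximal := fun hmax ↦ hne (Ideal.jacobson_eq_self_of_isMaximal (H := hmax))
  have hf0 : Ideal.Quotient.mk P f ≠ 0 := by rwa [Ne, Ideal.Quotient.eq_zero_iff_mem]
  have hf : ∀ q : Ideal (R ⧸ P), q.IsPrime → q ≠ ⊥ → Ideal.Quotient.mk P f ∈ q := by
    intro q hq hq0
    have hPq : P ≤ q.comap (Ideal.Quotient.mk P) := by
      simpa using Ideal.ker_le_comap (K := q) (Ideal.Quotient.mk P)
    have hlt : P < q.comap (Ideal.Quotient.mk P) := by
      refine lt_of_le_of_ne hPq fun heq ↦ hq0 ?_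
      rw [← Ideal.map_comap_of_surjective _ Ideal.Quotient.mk_surjective q, ← heq,
        Ideal.map_quotient_self]
    rw [← Ideal.mem_comap, ← ih _ hlt (hq.comap _)]
    exact Ideal.jacobson_mono hPq hfjac
  refine h P hP (ringKrullDim_eq_one_of_forall_mem
    (fun hF ↦ hPmax ((Ideal.Quotient.maximal_ideal_iff_isField_quotient P).2 hF)) hf0 hf) ?_
  refine (((Ideal.span {Ideal.Quotient.mk P f}).finite_minimalPrimes_of_isNoetherianRing
    (R ⧸ P)).image (Ideal.comap (Ideal.Quotient.mk P))).subset ?_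
  rintro m ⟨hPm, hm⟩
  have hker : RingHom.ker (Ideal.Quotient.mk P) ≤ m := by rwa [Ideal.mk_ker]
  have hmprime := hm.isPrime
  refine ⟨m.map (Ideal.Quotient.mk P),
    Ideal.mem_minimalPrimes_span_singleton_of_forall_mem hf0 hf
      (Ideal.map_isPrime_of_surjective Ideal.Quotient.mk_surjective hker) fun hbot ↦ hPmax ?_, ?_⟩
  · rw [Ideal.map_eq_bot_iff_le_ker, Ideal.mk_ker] at hbot
    exact le_antisymm hbot hPm ▸ hm
  · rw [Ideal.comap_map_of_surjective' _ Ideal.Quotient.mk_surjective, sup_eq_left.2 hker]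
end

section
/- Let a be an element of a Noetherian ring R and let U_a = { a^n(1 + a x) : n ∈ ℕ, x ∈ R }. Then U_a is a multiplicative set and the localization U_a^{-1} R is a Jacobson ring. -/
/-- In a Noetherian domain, a prime of height at least two strictly contains a nonzero prime
avoiding any given nonzero element. -/
theorem Ideal.exists_isPrime_lt_notMem_of_isDomain {R : Type*} [CommRing R] [IsDomain R]
    [IsNoetherianRing R] {q m : Ideal R} [q.IsPrime] [m.IsPrime] (hq : q ≠ ⊥) (hqm : q < m)
    {g : R} (hg : g ≠ 0) :
    ∃ r : Ideal R, r.IsPrime ∧ r ≠ ⊥ ∧ r < m ∧ g ∉ r := by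
  have eq_of_le_of_height_le_one {I J : Ideal R} [I.IsPrime] [J.IsPrime] (hI : I ≠ ⊥)
      (hJ : J.height ≤ 1) (hIJ : I ≤ J) : I = J := by
    by_contra hne
    have h := (height_strict_mono_of_isPrime_of_isPrime (lt_of_le_of_ne hIJ hne)).trans_le hJ
    exact hI (height_eq_zero_iff_eq_bot.mp (Order.lt_one_iff.mp h))
  have height_m : ¬ m.height ≤ 1 := fun h ↦ hqm.ne (eq_of_le_of_height_le_one hq h hqm.le)
  by_cases hu : IsUnit g
  · exact ⟨q, ‹_›, hq, hqm, fun h ↦ IsPrime.ne_top ‹_› (q.eq_top_of_isUnit_mem h hu)⟩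
  have hnot : ¬ ((m : Set R) ⊆ ⋃ p ∈ (span {g}).minimalPrimes, (p : Set R)) := by
    intro h
    obtain ⟨p, hp, hmp⟩ := (subset_union_prime_finite
      (finite_minimalPrimes_of_isNoetherianRing R (span {g})) (f := id) 0 0
      fun _ h _ _ ↦ h.1.1).1 h
    exact height_m ((height_mono hmp).trans
      (height_le_one_of_isPrincipal_of_mem_minimalPrimes (span {g}) p hp))
  obtain ⟨x, hxm, hx⟩ := Set.not_subset.mp hnot
  simp only [Set.mem_iUnion, not_exists, SetLike.mem_coe] at hx
  have hx0 : x ≠ 0 := by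
    rintro rfl
    obtain ⟨p, hp⟩ := nonempty_minimalPrimes (I := span {g}) (by simpa [span_singleton_eq_top])
    exact hx p hp p.zero_mem
  obtain ⟨r, hr, hrm⟩ := exists_minimalPrimes_le (I := span {x}) (J := m)
    ((span_singleton_le_iff_mem _).mpr hxm)
  have hr1 := height_le_one_of_isPrincipal_of_mem_minimalPrimes (span {x}) r hr
  have hxr : x ∈ r := (span_singleton_le_iff_mem _).mp hr.1.2
  have := hr.1.1
  refine ⟨r, hr.1.1, fun h ↦ hx0 (by simpa [h] using hxr), lt_of_le_of_ne hrm ?_, fun hgr ↦ ?_⟩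
  · rintro rfl
    exact height_m hr1
  · obtain ⟨p, hp, hpr⟩ := exists_minimalPrimes_le (I := span {g}) (J := r)
      ((span_singleton_le_iff_mem _).mpr hgr)
    have := hp.1.1
    have hgp : g ∈ p := (span_singleton_le_iff_mem _).mp hp.1.2
    have hpr' := eq_of_le_of_height_le_one (fun h ↦ hg (by simpa [h] using hgp)) hr1 hpr
    exact hx p hp (hpr' ▸ hxr)

/-- In a Noetherian ring, if some prime lies strictly between the primes `p` and `m`, then such a
prime can be found avoiding any given element outside `p`. -/
theorem Ideal.exists_isPrime_between_notMem {R : Type*} [CommRing R] [IsNoetherianRing R]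
    {p q m : Ideal R} [p.IsPrime] [q.IsPrime] [m.IsPrime] (hpq : p < q) (hqm : q < m)
    {g : R} (hg : g ∉ p) :
    ∃ r : Ideal R, r.IsPrime ∧ p < r ∧ r < m ∧ g ∉ r := by
  have hsurj : Function.Surjective (Ideal.Quotient.mk p) := Quotient.mk_surjective
  have comap_map {I : Ideal R} (h : p ≤ I) :
      (I.map (Ideal.Quotient.mk p)).comap (Ideal.Quotient.mk p) = I := by
    rw [comap_map_of_surjective _ hsurj, ← RingHom.ker_eq_comap_bot, mk_ker, sup_eq_left.mpr h]
  have hpm := hpq.le.trans hqm.le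
  have := map_isPrime_of_surjective (I := q) hsurj (by rw [mk_ker]; exact hpq.le)
  have := map_isPrime_of_surjective (I := m) hsurj (by rw [mk_ker]; exact hpm)
  obtain ⟨r, hr, hr0, hrm, hgr⟩ := exists_isPrime_lt_notMem_of_isDomain
    (q := q.map (Ideal.Quotient.mk p)) (m := m.map (Ideal.Quotient.mk p))
    (fun h ↦ by
      have := comap_map hpq.le
      rw [h, ← RingHom.ker_eq_comap_bot, mk_ker] at this
      exact hpq.ne this)
    (lt_of_le_of_ne (map_mono hqm.le) fun h ↦ hqm.ne <| by
      rw [← comap_map hpq.le, h, comap_map hpm])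
    (g := Ideal.Quotient.mk p g) (by rwa [Ne, Quotient.eq_zero_iff_mem])
  have strictMono {I J : Ideal (R ⧸ p)} (h : I < J) :
      I.comap (Ideal.Quotient.mk p) < J.comap (Ideal.Quotient.mk p) :=
    lt_of_le_of_ne (comap_mono h.le) fun h' ↦ h.ne (comap_injective_of_surjective _ hsurj h')
  refine ⟨r.comap (Ideal.Quotient.mk p), hr.comap _, ?_, comap_map hpm ▸ strictMono hrm, hgr⟩
  have h := strictMono (bot_lt_iff_ne_bot.mpr hr0)
  rwa [← RingHom.ker_eq_comap_bot, mk_ker] at h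

/-- The multiplicative set of elements of the form `a ^ n * (1 + a * x)`. -/
def boundarySubmonoid {R : Type*} [CommRing R] (a : R) : Submonoid R where
  carrier := {y : R | ∃ (n : ℕ) (x : R), y = a ^ n * (1 + a * x)}
  one_mem' := ⟨0, 0, by simp⟩
  mul_mem' := by
    rintro _ _ ⟨n, x, rfl⟩ ⟨k, y, rfl⟩
    exact ⟨n + k, x + y + a * x * y, by ring⟩

theorem mem_boundarySubmonoid {R : Type*} [CommRing R] {a y : R} :
    y ∈ boundarySubmonoid a ↔ ∃ (n : ℕ) (x : R), y = a ^ n * (1 + a * x) :=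
  Iff.rfl

theorem disjoint_boundarySubmonoid_of_le {R : Type*} [CommRing R] {a : R} {q m : Ideal R}
    [q.IsPrime] [m.IsPrime] (hqm : q ≤ m) (haq : a ∉ q) (ham : a ∈ m) :
    Disjoint (boundarySubmonoid a : Set R) q := by
  rw [Set.disjoint_left]
  rintro _ ⟨n, x, rfl⟩ h
  rcases Ideal.IsPrime.mem_or_mem ‹_› h with h | h
  · exact haq (Ideal.IsPrime.mem_of_pow_mem ‹_› n h)
  · exact (m.ne_top_iff_one.mp (Ideal.IsPrime.ne_top ‹_›))
      ((m.add_mem_iff_left (m.mul_mem_right x ham)).mp (hqm h))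

theorem notMem_of_disjoint_boundarySubmonoid {R : Type*} [CommRing R] {a : R} {q : Ideal R}
    (h : Disjoint (boundarySubmonoid a : Set R) q) : a ∉ q :=
  Set.disjoint_left.mp h (mem_boundarySubmonoid.mpr ⟨1, 0, by simp⟩)

theorem exists_isMaximal_of_disjoint_boundarySubmonoid {R : Type*} [CommRing R] {a : R}
    {q : Ideal R} (h : Disjoint (boundarySubmonoid a : Set R) q) :
    ∃ m : Ideal R, m.IsMaximal ∧ q ≤ m ∧ a ∈ m := by
  have hne : q ⊔ Ideal.span {a} ≠ ⊤ := by
    rw [Ne, Ideal.eq_top_iff_one, Submodule.mem_sup]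
    rintro ⟨y, hy, z, hz, hyz⟩
    obtain ⟨x, rfl⟩ := Ideal.mem_span_singleton'.mp hz
    refine Set.disjoint_left.mp h (mem_boundarySubmonoid.mpr ⟨0, -x, ?_⟩) hy
    linear_combination hyz
  obtain ⟨m, hm, hle⟩ := Ideal.exists_le_maximal _ hne
  exact ⟨m, hm, le_sup_left.trans hle,
    hle (Ideal.mem_sup_right (Ideal.mem_span_singleton_self a))⟩

/-- A prime of the boundary that is maximal among the primes avoiding the image of `g` is a maximal
ideal. -/
theorem isMaximal_of_maximal_notMem_boundary {R : Type*} [CommRing R] [IsNoetherianRing R]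
    {a g : R} {Q : Ideal (Localization (boundarySubmonoid a))}
    (hQ : Maximal (fun I ↦ I.IsPrime ∧ algebraMap R _ g ∉ I) Q) : Q.IsMaximal := by
  have := hQ.prop.1
  obtain ⟨M, hM, hQM⟩ := Q.exists_le_maximal this.ne_top
  by_contra hmax
  have hlt : Q < M := lt_of_le_of_ne hQM fun h ↦ hmax (h ▸ hM)
  have hdisj (I : Ideal (Localization (boundarySubmonoid a))) [hI : I.IsPrime] :
      Disjoint (boundarySubmonoid a : Set R) (I.under R) :=
    ((IsLocalization.isPrime_iff_isPrime_disjoint (boundarySubmonoid a) _ I).mp hI).2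
  have hunder : Q.under R < M.under R :=
    lt_of_le_of_ne (Ideal.comap_mono hQM) fun h ↦ hlt.ne <| by
      rw [← IsLocalization.map_under (boundarySubmonoid a) _ Q, h,
        IsLocalization.map_under (boundarySubmonoid a) _ M]
  obtain ⟨m, hm, hMm, ham⟩ := exists_isMaximal_of_disjoint_boundarySubmonoid (hdisj M)
  have hMm' : M.under R < m := lt_of_le_of_ne hMm fun h ↦
    notMem_of_disjoint_boundarySubmonoid (hdisj M) (h ▸ ham)
  have hag : a * g ∉ Q.under R := fun h ↦
    (Ideal.IsPrime.mem_or_mem inferInstance h).elim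
      (notMem_of_disjoint_boundarySubmonoid (hdisj Q)) hQ.prop.2
  obtain ⟨r, hr, hQr, hrm, hagr⟩ := Ideal.exists_isPrime_between_notMem hunder hMm' hag
  have hrdisj : Disjoint (boundarySubmonoid a : Set R) r :=
    disjoint_boundarySubmonoid_of_le hrm.le (fun h ↦ hagr (r.mul_mem_right g h)) ham
  have hrunder := IsLocalization.under_map_of_isPrime_disjoint (boundarySubmonoid a)
    (Localization (boundarySubmonoid a)) hr hrdisj
  have hle := hQ.le_of_ge (y := r.map (algebraMap R _))
    ⟨IsLocalization.isPrime_of_isPrime_disjoint (boundarySubmonoid a) _ r hr hrdisj,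
      fun h ↦ hagr (r.mul_mem_left a (hrunder.le h))⟩
    ((IsLocalization.map_under (boundarySubmonoid a) _ Q).ge.trans (Ideal.map_mono hQr.le))
  exact hQr.not_ge (Ideal.map_le_iff_le_comap.mp hle)

/-- **The boundary of `a` in `R` is Jacobson.** For an element `a` of a
Noetherian ring `R`, the set `U_a = { a^n (1 + a x) : n ∈ ℕ, x ∈ R }` is a
multiplicative set and the localization `U_a⁻¹ R` is a Jacobson ring. -/
theorem boundary_localization_isJacobson {R : Type*} [CommRing R]
    [IsNoetherianRing R] (a : R) :
    ∃ U : Submonoid R,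
      (U : Set R) = {y : R | ∃ (n : ℕ) (x : R), y = a ^ n * (1 + a * x)} ∧
        IsJacobsonRing (Localization U) := by
  refine ⟨boundarySubmonoid a, rfl, isJacobsonRing_iff_prime_eq.mpr fun P hP ↦
    le_antisymm (fun f hf ↦ ?_) Ideal.le_jacobson⟩
  by_contra hfP
  obtain ⟨⟨g, s⟩, hgs⟩ := IsLocalization.surj (boundarySubmonoid a) f
  have hgP : algebraMap R _ g ∉ P := by
    rw [← hgs, Ideal.mul_unit_mem_iff_mem _ (IsLocalization.map_units _ s)]
    exact hfP
  have : IsNoetherianRing (Localization (boundarySubmonoid a)) :=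
    IsLocalization.isNoetherianRing (boundarySubmonoid a) _ ‹_›
  obtain ⟨Q, hPQ, hQ⟩ := exists_maximal_ge_of_wellFoundedGT
    (fun I : Ideal (Localization (boundarySubmonoid a)) ↦ I.IsPrime ∧ algebraMap R _ g ∉ I) P
    ⟨hP, hgP⟩
  refine hQ.prop.2 (hgs ▸ Ideal.mul_mem_right _ _ ?_)
  exact Ideal.mem_sInf.mp hf ⟨hPQ, isMaximal_of_maximal_notMem_boundary hQ⟩
end

section
/- Let R be a Noetherian Jacobson ring, B a subalgebra of a finitely generated R-algebra, and A ⊆ B an R-subalgebra. Then dim(A) ≤ dim(B). -/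
universe u v

namespace PrimeSpectrum

/-- Krull's principal ideal theorem, relative to a prime `p`: a minimal prime over `p + (x)` has
no prime strictly between it and `p`. -/
lemma not_lt_of_mem_minimalPrimes_sup_span_singleton {A : Type*} [CommRing A] [IsNoetherianRing A]
    {p q r : PrimeSpectrum A} {x : A} (hpq : p < q)
    (hr : r.asIdeal ∈ (p.asIdeal ⊔ Ideal.span {x}).minimalPrimes) : ¬ q < r := by
  intro hqr
  let e := p.asIdeal.primeSpectrumQuotientOrderIsoZeroLocus.symm
  have h : (e ⟨r, (hpq.trans hqr).le⟩).asIdeal.height ≤ 1 :=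
    Ideal.map_height_le_one_of_mem_minimalPrimes hr
  have hq : (e ⟨q, hpq.le⟩).asIdeal.height ≤ 0 :=
    Order.lt_one_iff_nonpos.mp (Ideal.height_le_iff.mp h _ inferInstance
      (show e ⟨q, hpq.le⟩ < e ⟨r, (hpq.trans hqr).le⟩ from e.lt_iff_lt.mpr hqr))
  exact not_lt_zero (Ideal.height_le_iff.mp hq _ inferInstance
    (show e ⟨p, le_refl p⟩ < e ⟨q, hpq.le⟩ from e.lt_iff_lt.mpr hpq))

/-- In a Noetherian ring, a prime strictly between `p` and `r` can be chosen to avoid a given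
element outside `p`. -/
lemma exists_notMem_of_lt_of_lt {A : Type*} [CommRing A] [IsNoetherianRing A]
    {p q r : PrimeSpectrum A} {a : A} (ha : a ∉ p.asIdeal) (hpq : p < q) (hqr : q < r) :
    ∃ q' : PrimeSpectrum A, p < q' ∧ q' < r ∧ a ∉ q'.asIdeal := by
  by_cases har : a ∈ r.asIdeal
  swap
  · exact ⟨q, hpq, hqr, fun h ↦ har (hqr.le h)⟩
  set S := (p.asIdeal ⊔ Ideal.span {a}).minimalPrimes
  have hSfin : S.Finite := Ideal.finite_minimalPrimes_of_isNoetherianRing A _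
  have har' : p.asIdeal ⊔ Ideal.span {a} ≤ r.asIdeal :=
    sup_le (hpq.trans hqr).le ((Ideal.span_singleton_le_iff_mem _).mpr har)
  obtain ⟨y, hyr, hy⟩ : ∃ y ∈ r.asIdeal, ∀ s ∈ S, y ∉ s := by
    by_contra! hcon
    obtain ⟨s, hs, hrs⟩ := (Ideal.subset_union_prime_finite hSfin (f := id) (I := r.asIdeal) ⊥ ⊥
      fun _ hs _ _ ↦ hs.isPrime).1 fun y hy ↦ by
        obtain ⟨s, hs, hys⟩ := hcon y hy
        exact Set.mem_biUnion hs hys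
    have hrS : r.asIdeal ∈ S := by
      rwa [le_antisymm hrs (hs.2 ⟨r.isPrime, har'⟩ hrs)]
    exact not_lt_of_mem_minimalPrimes_sup_span_singleton hpq hrS hqr
  have hyr' : p.asIdeal ⊔ Ideal.span {y} ≤ r.asIdeal :=
    sup_le (hpq.trans hqr).le ((Ideal.span_singleton_le_iff_mem _).mpr hyr)
  obtain ⟨t, ht, htr⟩ := Ideal.exists_minimalPrimes_le hyr'
  have htp := ht.isPrime
  let t' : PrimeSpectrum A := ⟨t, htp⟩
  have hpt : p.asIdeal ≤ t := le_sup_left.trans ht.1.2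
  have hyt : y ∈ t := ht.1.2 (Ideal.mem_sup_right (Ideal.mem_span_singleton_self y))
  have hyp : y ∉ p.asIdeal := fun h ↦ by
    obtain ⟨s, hs, -⟩ := Ideal.exists_minimalPrimes_le har'
    exact hy s hs (hs.1.2 (Ideal.mem_sup_left h))
  refine ⟨t', lt_of_le_not_ge hpt fun h ↦ hyp (h hyt), lt_of_le_of_ne htr fun h ↦ ?_, fun hat ↦ ?_⟩
  · subst h
    exact not_lt_of_mem_minimalPrimes_sup_span_singleton hpq ht hqr
  · obtain ⟨s, hs, hst⟩ := Ideal.exists_minimalPrimes_le (I := p.asIdeal ⊔ Ideal.span {a})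
      (J := t) (sup_le hpt ((Ideal.span_singleton_le_iff_mem _).mpr hat))
    let s' : PrimeSpectrum A := ⟨s, hs.isPrime⟩
    have hps : p < s' := lt_of_le_not_ge (le_sup_left.trans hs.1.2) fun h ↦
      ha (h (hs.1.2 (Ideal.mem_sup_right (Ideal.mem_span_singleton_self a))))
    refine not_lt_of_mem_minimalPrimes_sup_span_singleton (r := t') hps ht
      (lt_of_le_not_ge hst fun h ↦ hy s hs (h hyt))

/-- In a Noetherian Jacobson ring, chains of primes starting at `p` can be modified to avoid
a given element outside `p`. -/
lemma exists_ltSeries_notMem_last {A : Type*} [CommRing A] [IsNoetherianRing A] [IsJacobsonRing A]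
    {a : A} (n : ℕ) (p : PrimeSpectrum A) (ha : a ∉ p.asIdeal) (hn : n ≤ Order.coheight p) :
    ∃ l : LTSeries (PrimeSpectrum A), l.length = n ∧ l.head = p ∧ a ∉ l.last.asIdeal := by
  induction n generalizing p with
  | zero => exact ⟨RelSeries.singleton _ p, rfl, rfl, ha⟩
  | succ n ih =>
    suffices ∃ q, p < q ∧ a ∉ q.asIdeal ∧ n ≤ Order.coheight q by
      obtain ⟨q, hpq, haq, hq⟩ := this
      obtain ⟨l, hl, rfl, hal⟩ := ih q haq hq
      exact ⟨l.cons p hpq, by simp [hl], by simp, by simpa using hal⟩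
    obtain ⟨l, rfl, hl⟩ := Order.exists_series_of_le_coheight p hn
    rcases n with _ | n
    · have h01 : l.head < l.last := l.strictMono (Fin.mk_lt_mk.mpr (by simp [hl]))
      have hjac : l.head.asIdeal.jacobson = l.head.asIdeal :=
        IsJacobsonRing.out ‹_› l.head.isPrime.isRadical
      rw [← hjac, Ideal.jacobson, Submodule.mem_sInf] at ha
      push Not at ha
      obtain ⟨m, ⟨hle, hm⟩, ham⟩ := ha
      refine ⟨⟨m, hm.isPrime⟩, lt_of_le_of_ne hle fun h ↦ ?_, ham, zero_le⟩
      have hmax : l.head.asIdeal.IsMaximal := by rwa [h]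
      exact h01.ne (PrimeSpectrum.ext (hmax.eq_of_le l.last.isPrime.ne_top h01.le))
    · have h01 : l.head < l ⟨1, by omega⟩ := l.strictMono (Fin.mk_lt_mk.mpr (by simp))
      have h12 : l ⟨1, by omega⟩ < l ⟨2, by omega⟩ := l.strictMono (Fin.mk_lt_mk.mpr (by simp))
      obtain ⟨q, hpq, hqr, haq⟩ := exists_notMem_of_lt_of_lt ha h01 h12
      refine ⟨q, hpq, haq, le_trans ?_ (Order.coheight_add_one_le hqr)⟩
      have hrev := Order.rev_index_le_coheight l ⟨2, by omega⟩
      have hval : (Fin.rev (⟨2, by omega⟩ : Fin (l.length + 1)) : ℕ) = n := by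
        simp only [Fin.val_rev]; omega
      rw [hval] at hrev
      push_cast
      gcongr

/-- An algebra of finite type containing a domain `A` maps to a field algebraic over `A`, in which
`A` still embeds. -/
lemma _root_.Algebra.FiniteType.exists_algHom_field_isAlgebraic {A : Type u} {C : Type v}
    [CommRing A] [IsDomain A] [CommRing C] [Algebra A C] [Algebra.FiniteType A C]
    (hinj : Function.Injective (algebraMap A C)) :
    ∃ (L : Type (max u v)) (_ : Field L) (_ : Algebra A L) (_ : C →ₐ[A] L),
      Algebra.IsAlgebraic A L ∧ Function.Injective (algebraMap A L) := by
  let K := FractionRing A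
  let T := TensorProduct A K C
  have : Nontrivial T := by
    have hK : Function.Injective (algebraMap K T) :=
      Algebra.TensorProduct.includeLeft_injective (S := K) hinj
    exact hK.nontrivial
  obtain ⟨m, hm⟩ := Ideal.exists_maximal T
  let _ : Field (T ⧸ m) := Ideal.Quotient.field m
  have : Algebra.FiniteType K (T ⧸ m) := inferInstance
  have : Module.Finite K (T ⧸ m) := finite_of_finite_type_of_isJacobsonRing K _
  refine ⟨T ⧸ m, inferInstance, inferInstance,
    (Ideal.Quotient.mkₐ A m).comp Algebra.TensorProduct.includeRight, ?_, ?_⟩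
  · exact (IsFractionRing.comap_isAlgebraic_iff (A := A) (K := K)).2
      (Algebra.IsAlgebraic.of_finite K (T ⧸ m))
  · rw [IsScalarTower.algebraMap_eq A K (T ⧸ m)]
    exact (algebraMap K (T ⧸ m)).injective.comp (IsFractionRing.injective A K)

/-- A strictly increasing family of primes avoiding `a` extends to the localization away
from `a`. -/
lemma exists_strictMono_comap_away_eq {A : Type*} [CommRing A] (a : A) {ι : Type*} [Preorder ι]
    {l : ι → PrimeSpectrum A} (hl : StrictMono l) (ha : ∀ i, a ∉ (l i).asIdeal) :
    ∃ Q : ι → PrimeSpectrum (Localization.Away a), StrictMono Q ∧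
      ∀ i, comap (algebraMap A (Localization.Away a)) (Q i) = l i := by
  have hrange (i : ι) : l i ∈ Set.range (comap (algebraMap A (Localization.Away a))) := by
    rw [localization_away_comap_range (Localization.Away a) a]
    exact ha i
  choose Q hQ using hrange
  refine ⟨Q, fun i j hij ↦ lt_of_le_of_ne ?_ fun h ↦ ?_, hQ⟩
  · have hmap (i : ι) : (Q i).asIdeal = (l i).asIdeal.map (algebraMap A (Localization.Away a)) := by
      rw [← hQ i]
      exact (IsLocalization.map_under (.powers a) _ _).symm
    change (Q i).asIdeal ≤ (Q j).asIdeal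
    rw [hmap, hmap]
    exact Ideal.map_mono (hl hij).le
  · exact (hl hij).ne (by rw [← hQ i, ← hQ j, h])

/-- For an integral extension, chains of primes lift. -/
lemma exists_monotone_comap_eq_of_isIntegral {A D : Type*} [CommRing A] [CommRing D] [Algebra A D]
    [Algebra.IsIntegral A D] (hinj : Function.Injective (algebraMap A D))
    (l : LTSeries (PrimeSpectrum A)) :
    ∃ F : Fin (l.length + 1) → PrimeSpectrum D, Monotone F ∧
      ∀ i, comap (algebraMap A D) (F i) = l i := by
  obtain ⟨P, -, hP, hover⟩ := Ideal.exists_ideal_over_prime_of_isIntegral (S := D) l.head.asIdeal ⊥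
    (by rw [← RingHom.ker_eq_comap_bot, (RingHom.injective_iff_ker_eq_bot _).1 hinj]; exact bot_le)
  have : P.LiesOver l.head.asIdeal := ⟨hover.symm⟩
  obtain ⟨⟨n, F, hF⟩, hn, -, hmap⟩ := Ideal.exists_ltSeries_of_hasGoingUp l P
  dsimp only at hn
  subst hn
  refine ⟨F, (LTSeries.strictMono ⟨_, F, hF⟩).monotone, fun i ↦ ?_⟩
  rw [RelSeries.toList, RelSeries.toList, List.map_ofFn] at hmap
  exact congrFun (List.ofFn_injective hmap) i

/-- For an algebra of finite type containing a domain `A`, all chains of primes of `A` avoiding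
some nonzero element lift. -/
lemma exists_ne_zero_forall_ltSeries_lift {A : Type u} {C : Type v}
    [CommRing A] [IsDomain A] [CommRing C] [Algebra A C] [Algebra.FiniteType A C]
    (hinj : Function.Injective (algebraMap A C)) :
    ∃ a : A, a ≠ 0 ∧ ∀ l : LTSeries (PrimeSpectrum A), a ∉ l.last.asIdeal →
      ∃ F : Fin (l.length + 1) → PrimeSpectrum C, Monotone F ∧
        ∀ i, comap (algebraMap A C) (F i) = l i := by
  obtain ⟨L, _, _, φ, halg, hL⟩ := Algebra.FiniteType.exists_algHom_field_isAlgebraic hinj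
  obtain ⟨s, hs⟩ := Algebra.FiniteType.out (R := A) (A := C)
  choose y hy0 hy using fun c : C ↦ (halg.isAlgebraic (φ c)).exists_integral_multiple
  let a := ∏ c ∈ s, y c
  have ha0 : a ≠ 0 := Finset.prod_ne_zero_iff.2 fun c _ ↦ hy0 c
  refine ⟨a, ha0, fun l hl ↦ ?_⟩
  have haL : IsUnit (algebraMap A L a) :=
    isUnit_iff_ne_zero.2 ((map_ne_zero_iff _ hL).2 ha0)
  let g : Localization.Away a →+* L := IsLocalization.Away.lift a haL
  let _ : Algebra (Localization.Away a) L := g.toAlgebra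
  have : IsScalarTower A (Localization.Away a) L :=
    .of_algebraMap_eq fun x ↦ (IsLocalization.Away.lift_eq a haL x).symm
  let D := integralClosure (Localization.Away a) L
  have hφ (c : C) : φ c ∈ D := by
    suffices (⊤ : Subalgebra A C) ≤ (D.restrictScalars A).comap φ from this Algebra.mem_top
    rw [← hs, Algebra.adjoin_le_iff]
    intro c hc
    have hac : IsIntegral (Localization.Away a) (a • φ c) := by
      have : IsIntegral A (a • φ c) := by
        obtain ⟨b, hb⟩ := Finset.dvd_prod_of_mem y hc
        rw [show a = b * y c by rw [mul_comm]; exact hb, mul_smul]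
        exact (hy c).smul b
      exact this.tower_top
    have hinv := hac.smul (IsLocalization.Away.invSelf a : Localization.Away a)
    rw [← algebraMap_smul (Localization.Away a) a (φ c), smul_smul, mul_comm,
      IsLocalization.Away.mul_invSelf, one_smul] at hinv
    exact hinv
  let ψ : C →+* D := (φ : C →+* L).codRestrict D hφ
  have hgD : Function.Injective (algebraMap (Localization.Away a) D) := by
    have hg : Function.Injective (algebraMap (Localization.Away a) L) := by
      refine (IsLocalization.lift_injective_iff _).2 fun x y ↦ ?_
      rw [hL.eq_iff, (IsLocalization.injective (Localization.Away a)
        (powers_le_nonZeroDivisors_of_noZeroDivisors ha0)).eq_iff]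
    rw [IsScalarTower.algebraMap_eq (Localization.Away a) D L] at hg
    exact Function.Injective.of_comp (f := algebraMap D L) hg
  obtain ⟨Q, hQmono, hQ⟩ := exists_strictMono_comap_away_eq a l.strictMono
    fun i h ↦ hl (l.monotone (Fin.le_last i) h)
  obtain ⟨F, hFmono, hF⟩ := exists_monotone_comap_eq_of_isIntegral hgD (LTSeries.mk _ Q hQmono)
  refine ⟨fun i ↦ comap ψ (F i), fun i j hij ↦ Ideal.comap_mono (hFmono hij), fun i ↦ ?_⟩
  rw [← hQ i]
  refine Eq.trans ?_ (congrArg _ (hF i))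
  rw [← comap_comp_apply, ← comap_comp_apply]
  congr 1
  ext x
  exact (φ.commutes x).trans (IsScalarTower.algebraMap_apply A (Localization.Away a) L x)

/-- A chain of primes containing the prime `p` gives a chain of primes of `A ⧸ p`. -/
lemma length_le_coheight_bot_quotient {A : Type*} [CommRing A] {p : Ideal A} [p.IsPrime]
    (l : LTSeries (PrimeSpectrum A)) (hpl : p ≤ l.head.asIdeal) :
    (l.length : ℕ∞) ≤ Order.coheight (⊥ : PrimeSpectrum (A ⧸ p)) := by
  let l' : LTSeries (PrimeSpectrum (A ⧸ p)) := LTSeries.mk l.length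
    (fun i ↦ p.primeSpectrumQuotientOrderIsoZeroLocus.symm ⟨l i, hpl.trans (l.head_le i)⟩)
    fun i j hij ↦ (OrderIso.lt_iff_lt _).2 (l.strictMono hij)
  exact Order.length_le_coheight (p := l') bot_le

/-- If `A` is a Noetherian Jacobson ring contained in an algebra `C` of finite type, then any chain
of primes in `A` has the length of some chain of primes in `C` that remains strict in `A`. -/
lemma exists_monotone_strictMono_comap {A : Type u} {C : Type v}
    [CommRing A] [IsNoetherianRing A] [IsJacobsonRing A] [CommRing C] [Algebra A C]
    [Algebra.FiniteType A C] (hinj : Function.Injective (algebraMap A C))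
    (l : LTSeries (PrimeSpectrum A)) :
    ∃ F : Fin (l.length + 1) → PrimeSpectrum C, Monotone F ∧
      StrictMono fun i ↦ comap (algebraMap A C) (F i) := by
  obtain ⟨p, hp, hpl⟩ := Ideal.exists_minimalPrimes_le (bot_le : ⊥ ≤ l.head.asIdeal)
  have hpp := hp.isPrime
  obtain ⟨q, hq, hqp⟩ := Ideal.exists_comap_eq_of_mem_minimalPrimes_of_injective hinj p hp
  have : q.LiesOver p := ⟨hqp.symm⟩
  have hinj' : Function.Injective (algebraMap (A ⧸ p) (C ⧸ q)) :=
    FaithfulSMul.algebraMap_injective _ _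
  have : Algebra.FiniteType A (C ⧸ q) := inferInstance
  have : Algebra.FiniteType (A ⧸ p) (C ⧸ q) := .of_restrictScalars_finiteType A _ _
  obtain ⟨a, ha0, ha⟩ := exists_ne_zero_forall_ltSeries_lift hinj'
  have hcoh := length_le_coheight_bot_quotient l hpl
  obtain ⟨l', hlen, -, hal⟩ := exists_ltSeries_notMem_last (a := a) l.length ⊥
    (fun h ↦ ha0 (Ideal.mem_bot.1 h)) hcoh
  obtain ⟨F, hFmono, hF⟩ := ha l' hal
  rw [← hlen]
  refine ⟨fun i ↦ comap (Ideal.Quotient.mk q) (F i), fun i j hij ↦ Ideal.comap_mono (hFmono hij),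
    fun i j hij ↦ ?_⟩
  have key (i) : comap (algebraMap A C) (comap (Ideal.Quotient.mk q) (F i)) =
      comap (Ideal.Quotient.mk p) (l' i) := by
    rw [← hF i, ← comap_comp_apply, ← comap_comp_apply]
    rfl
  simp only [key]
  exact lt_of_le_of_ne (Ideal.comap_mono (l'.strictMono hij).le) fun h ↦
    (l'.strictMono hij).ne (comap_injective_of_surjective _ Ideal.Quotient.mk_surjective h)

end PrimeSpectrum

open PrimeSpectrum in
/-- Let `R` be a Noetherian Jacobson ring, `B` a subalgebra of a finitely
generated `R`-algebra `C` (via an injective algebra map), and `A ⊆ B` an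
`R`-subalgebra. Then `dim A ≤ dim B`. -/
theorem ringKrullDim_subalgebra_le {R B C : Type*} [CommRing R]
    [IsNoetherianRing R] [IsJacobsonRing R] [CommRing B] [Algebra R B]
    [CommRing C] [Algebra R C] [Algebra.FiniteType R C]
    (g : B →ₐ[R] C) (hg : Function.Injective g) (A : Subalgebra R B) :
    ringKrullDim A ≤ ringKrullDim B := by
  refine iSup_le fun l ↦ ?_
  choose x hx hx' using fun i : Fin l.length ↦ SetLike.exists_of_lt
    (show (l i.castSucc).asIdeal < (l i.succ).asIdeal from l.step i)
  let A' : Subalgebra R A := Algebra.adjoin R (Set.range x)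
  have : Algebra.FiniteType R A' :=
    (Subalgebra.fg_iff_finiteType _).1 (⟨(Set.finite_range x).toFinset, by simp [A']⟩)
  have : IsNoetherianRing A' := Algebra.FiniteType.isNoetherianRing R A'
  have : IsJacobsonRing A' := isJacobsonRing_of_finiteType (A := R)
  let l' : LTSeries (PrimeSpectrum A') :=
    { length := l.length
      toFun := fun i ↦ comap (algebraMap A' A) (l i)
      step := fun i ↦ lt_of_le_not_ge (Ideal.comap_mono (l.step i).le) fun h ↦
        hx' i (h (x := ⟨x i, Algebra.subset_adjoin (Set.mem_range_self i)⟩) (hx i)) }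
  let f : A' →ₐ[R] B := A.val.comp A'.val
  let _ : Algebra A' C := (g.comp f).toAlgebra
  have : IsScalarTower R A' C := .of_algebraMap_eq fun r ↦ ((g.comp f).commutes r).symm
  have : Algebra.FiniteType A' C := .of_restrictScalars_finiteType R _ _
  obtain ⟨F, hFmono, hF⟩ := exists_monotone_strictMono_comap (A := A') (C := C)
    (hg.comp (Subtype.val_injective.comp Subtype.val_injective)) l'
  refine Order.LTSeries.length_le_krullDim (LTSeries.mk l.length (fun i ↦ comap (g : B →+* C) (F i))
    fun i j hij ↦ lt_of_le_of_ne (Ideal.comap_mono (hFmono hij.le)) fun h ↦ ?_)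
  exact (hF hij).ne (congrArg (comap (f : A' →+* B)) h)
end

section
/- Let R be a ring finitely generated as a ℤ-algebra, G a group of ring automorphisms of R, and H ⊆ G a subgroup. Then dim(R^G) ≤ dim(R^H), where R^G and R^H denote the fixed subrings. -/
/-- The subring of elements fixed by every automorphism in a subgroup `G` of
the automorphism group of `R`. -/
def fixedSubring (R : Type*) [CommRing R] (G : Subgroup (RingAut R)) : Subring R where
  carrier := {x | ∀ g ∈ G, g x = x}
  zero_mem' := fun g _ => map_zero g
  one_mem' := fun g _ => map_one g
  add_mem' := fun {x y} hx hy g hg => by rw [map_add, hx g hg, hy g hg]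
  mul_mem' := fun {x y} hx hy g hg => by rw [map_mul, hx g hg, hy g hg]
  neg_mem' := fun {x} hx g hg => by rw [map_neg, hx g hg]

/-- A domain of finite type over a subring `S` is algebraic over a polynomial ring over `S`. -/
theorem exists_injective_mvPolynomial_isAlgebraic (S R : Type*) [CommRing S] [CommRing R]
    [IsDomain R] [Algebra S R] [FaithfulSMul S R] [Algebra.FiniteType S R] :
    ∃ (d : ℕ) (f : MvPolynomial (Fin d) S →ₐ[S] R), Function.Injective f ∧
      @Algebra.IsAlgebraic (MvPolynomial (Fin d) S) R _ _ f.toRingHom.toAlgebra := by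
  have : IsDomain S := (FaithfulSMul.algebraMap_injective S R).isDomain
  obtain ⟨s, hs⟩ := ‹Algebra.FiniteType S R›
  have : Algebra.IsAlgebraic (Algebra.adjoin S (s : Set R)) R :=
    ⟨fun x ↦ isAlgebraic_algebraMap (⟨x, hs ▸ trivial⟩ : Algebra.adjoin S (s : Set R))⟩
  obtain ⟨t, hts, ht⟩ := exists_isTranscendenceBasis_subset (R := S) (s : Set R)
  have : Finite t := s.finite_toSet.subset hts
  have hx := ht.comp_equiv (Finite.equivFin t).symm
  set x : Fin (Nat.card t) → R := Subtype.val ∘ (Finite.equivFin t).symm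
  refine ⟨_, MvPolynomial.aeval x, hx.1, ?_⟩
  have h := hx.isAlgebraic
  let := (MvPolynomial.aeval x : MvPolynomial _ S →ₐ[S] R).toRingHom.toAlgebra
  refine ⟨fun r ↦ ?_⟩
  obtain ⟨p, hp, hpr⟩ := h.1 r
  refine ⟨p.map (hx.1.aevalEquiv.symm : _ →+* _), ?_, ?_⟩
  · rwa [Ne, Polynomial.map_eq_zero_iff hx.1.aevalEquiv.symm.injective]
  · rw [Polynomial.aeval_def, Polynomial.eval₂_map]
    convert hpr
    rw [Polynomial.aeval_def]
    congr 1
    ext a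
    obtain ⟨b, rfl⟩ := hx.1.aevalEquiv.surjective a
    change MvPolynomial.aeval x (hx.1.aevalEquiv.symm (hx.1.aevalEquiv b)) = _
    rw [AlgEquiv.symm_apply_apply, hx.1.algebraMap_aevalEquiv]

/-- Adjoining an algebraic element to a Noetherian domain does not increase the dimension. -/
theorem ringKrullDim_adjoin_singleton_le {A S : Type*} [CommRing A] [IsNoetherianRing A]
    [CommRing S] [IsDomain A] [Algebra A S] {x : S} (hx : IsAlgebraic A x) :
    ringKrullDim (Algebra.adjoin A {x}) ≤ ringKrullDim A := by
  obtain ⟨p, hp, hpx⟩ := hx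
  have h := ringKrullDim_succ_le_of_surjective
    (Polynomial.aeval (R := A)
      (⟨x, Algebra.self_mem_adjoin_singleton A x⟩ : Algebra.adjoin A {x})).toRingHom
    ?_ (r := p) (mem_nonZeroDivisors_of_ne_zero hp) ?_
  · rw [Polynomial.ringKrullDim_of_isNoetherianRing] at h
    exact ENat.WithBot.add_le_add_one_right_iff.mp h
  · rintro ⟨y, hy⟩
    obtain ⟨q, rfl⟩ := Algebra.adjoin_singleton_eq_range_aeval A x ▸ hy
    exact ⟨q, Subtype.ext (by simp [Polynomial.aeval_subalgebra_coe])⟩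
  · exact Subtype.ext (by simp [Polynomial.aeval_subalgebra_coe, hpx])

/-- An algebraic extension of finite type of a Noetherian domain does not increase the dimension. -/
theorem ringKrullDim_le_of_isAlgebraic_of_finiteType (A S : Type*) [CommRing A]
    [IsNoetherianRing A] [CommRing S] [IsDomain S] [Algebra A S] [FaithfulSMul A S]
    [Algebra.IsAlgebraic A S] [Algebra.FiniteType A S] : ringKrullDim S ≤ ringKrullDim A := by
  have : IsDomain A := (FaithfulSMul.algebraMap_injective A S).isDomain
  suffices h : ∀ s : Finset S, ringKrullDim (Algebra.adjoin A (s : Set S)) ≤ ringKrullDim A by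
    obtain ⟨s, hs⟩ := ‹Algebra.FiniteType A S›
    have := h s
    rw [hs] at this
    rwa [ringKrullDim_eq_of_ringEquiv (Subalgebra.topEquiv (R := A) (A := S)).toRingEquiv] at this
  classical
  intro s
  induction s using Finset.induction_on with
  | empty =>
    refine ringKrullDim_le_of_surjective (algebraMap A _) ?_
    rintro ⟨y, hy⟩
    simp only [Finset.coe_empty, Algebra.adjoin_empty] at hy
    obtain ⟨a, rfl⟩ := Algebra.mem_bot.1 hy
    exact ⟨a, rfl⟩
  | insert x s _ ih =>
    have := Algebra.FiniteType.adjoin_of_finite (R := A) s.finite_toSet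
    have : IsNoetherianRing (Algebra.adjoin A (s : Set S)) :=
      Algebra.FiniteType.isNoetherianRing A _
    have halg : IsAlgebraic (Algebra.adjoin A (s : Set S)) x :=
      (Algebra.IsAlgebraic.isAlgebraic (R := A) x).extendScalars
        (FaithfulSMul.algebraMap_injective A _)
    refine le_trans ?_ ((ringKrullDim_adjoin_singleton_le halg).trans ih)
    refine (ringKrullDim_eq_of_ringEquiv ?_).le
    refine RingEquiv.subringCongr (s := (Algebra.adjoin A ((insert x s : Finset S) : Set S)).toSubring)
      (t := (Algebra.adjoin (Algebra.adjoin A (s : Set S)) {x}).toSubring) ?_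
    have := Algebra.adjoin_union_eq_adjoin_adjoin A (s : Set S) {x}
    ext y
    rw [Finset.coe_insert, Set.insert_eq, Set.union_comm]
    simp only [Subalgebra.mem_toSubring]
    rw [this]
    rfl

open Polynomial in
/-- If every nonzero element of `D` avoids a prime of height at least `n`, then every nonzero
polynomial over `D` avoids a prime of height at least `n + 1`. -/
theorem exists_notMem_height_polynomial {D : Type*} [CommRing D] {n : ℕ∞}
    (h : ∀ s : D, s ≠ 0 → ∃ q : PrimeSpectrum D, s ∉ q.asIdeal ∧ n ≤ Order.height q)
    (s : D[X]) (hs : s ≠ 0) :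
    ∃ q : PrimeSpectrum D[X], s ∉ q.asIdeal ∧ n + 1 ≤ Order.height q := by
  obtain ⟨q, hq, hn⟩ := h _ (leadingCoeff_ne_zero.mpr hs)
  let φ : D[X] →+* (D ⧸ q.asIdeal)[X] := mapRingHom (Ideal.Quotient.mk q.asIdeal)
  have hφ : Function.Surjective φ := map_surjective _ Ideal.Quotient.mk_surjective
  have hφs : φ s ≠ 0 := by
    intro h0
    apply hq
    have := congrArg (coeff · s.natDegree) h0
    simpa [φ, Ideal.Quotient.eq_zero_iff_mem] using this
  have hdeg : (X * φ s + 1).natDegree = (φ s).natDegree + 1 := by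
    rw [← C_1, natDegree_add_C, natDegree_X_mul hφs]
  have hunit : ¬ IsUnit (X * φ s + 1) := fun hu ↦ by
    simp [natDegree_eq_zero_of_isUnit hu] at hdeg
  obtain ⟨M, hM, hmem⟩ := exists_max_ideal_of_mem_nonunits hunit
  have hsM : φ s ∉ M := fun h ↦ hM.ne_top <| (Ideal.eq_top_iff_one M).mpr <| by
    simpa using M.sub_mem hmem (M.mul_mem_left X h)
  let e : PrimeSpectrum D → PrimeSpectrum D[X] := fun p ↦
    ⟨p.asIdeal.map C, Ideal.isPrime_map_C_of_isPrime⟩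
  have he : StrictMono e := by
    refine Monotone.strictMono_of_injective (fun p p' h ↦ Ideal.map_mono h) fun p p' h ↦ ?_
    ext x
    have hC : ∀ p : PrimeSpectrum D, C x ∈ (e p).asIdeal ↔ x ∈ p.asIdeal := fun p ↦ by
      refine ⟨fun hx ↦ ?_, Ideal.mem_map_of_mem C⟩
      simpa using Ideal.mem_map_C_iff.mp hx 0
    rw [← hC, ← hC, h]
  refine ⟨⟨M.comap φ, Ideal.IsPrime.comap φ⟩, hsM, ?_⟩
  refine (add_le_add_left (hn.trans (Order.height_le_height_apply_of_strictMono e he q)) 1).trans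
    (Order.height_add_one_le (lt_of_le_of_ne ?_ ?_))
  · change q.asIdeal.map C ≤ _
    rw [Ideal.map_le_iff_le_comap]
    intro x hx
    simp [φ, Ideal.Quotient.eq_zero_iff_mem.mpr hx]
  · intro heq
    obtain ⟨f, hf⟩ := hφ (X * φ s + 1)
    have h1 : f ∈ (e q).asIdeal := heq ▸ (show φ f ∈ M from hf ▸ hmem)
    have h2 : φ f = 0 := by
      ext i
      simpa [φ, Ideal.Quotient.eq_zero_iff_mem] using Ideal.mem_map_C_iff.mp h1 i
    rw [← hf, h2] at hdeg
    simp at hdeg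

/-- If every nonzero element of `D` avoids a prime of height at least `n`, then every nonzero
polynomial in `d` variables over `D` avoids a prime of height at least `n + d`. -/
theorem exists_notMem_height_mvPolynomial {D : Type*} [CommRing D] {n : ℕ∞}
    (h : ∀ s : D, s ≠ 0 → ∃ q : PrimeSpectrum D, s ∉ q.asIdeal ∧ n ≤ Order.height q)
    (d : ℕ) (s : MvPolynomial (Fin d) D) (hs : s ≠ 0) :
    ∃ q : PrimeSpectrum (MvPolynomial (Fin d) D), s ∉ q.asIdeal ∧ n + d ≤ Order.height q := by
  induction d with
  | zero =>
    let e := (MvPolynomial.isEmptyRingEquiv D (Fin 0))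
    obtain ⟨q, hq, hn⟩ := h (e s) (by simpa using hs)
    refine ⟨PrimeSpectrum.comapEquiv e.symm q, hq, ?_⟩
    rwa [Order.height_orderIso, Nat.cast_zero, add_zero]
  | succ d ih =>
    let e := (MvPolynomial.finSuccEquiv D d).toRingEquiv
    obtain ⟨q, hq, hn⟩ := exists_notMem_height_polynomial ih (e s) (by simpa using hs)
    refine ⟨PrimeSpectrum.comapEquiv e.symm q, hq, ?_⟩
    rwa [Order.height_orderIso, Nat.cast_succ, ← add_assoc]

/-- Chains of primes of `S` avoiding a suitable nonzero `s : S` lift to any algebraic extension of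
finite type which is a domain: `R` becomes integral over `S` after inverting `s`. -/
theorem exists_forall_ltSeries_lift_of_isAlgebraic (S R : Type*) [CommRing S] [CommRing R]
    [IsDomain R] [Algebra S R] [FaithfulSMul S R] [Algebra.IsAlgebraic S R]
    [Algebra.FiniteType S R] :
    ∃ s : S, s ≠ 0 ∧ ∀ l : LTSeries (PrimeSpectrum S), s ∉ l.last.asIdeal →
      ∃ L : Fin (l.length + 1) → PrimeSpectrum R, Monotone L ∧
        ∀ i, (L i).comap (algebraMap S R) = l i := by
  have : IsDomain S := (FaithfulSMul.algebraMap_injective S R).isDomain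
  obtain ⟨t, ht⟩ := ‹Algebra.FiniteType S R›
  obtain ⟨c, hc, hint⟩ := Algebra.IsAlgebraic.exists_integral_multiples S t
  refine ⟨c, hc, fun l hl ↦ ?_⟩
  let Sc := Localization.Away c
  let Rc := Localization.Away (algebraMap S R c)
  let : Algebra Sc Rc := (Localization.awayMap (algebraMap S R) c).toAlgebra
  have : IsScalarTower S Sc Rc := IsScalarTower.of_algebraMap_eq' (by
    ext x
    simp [RingHom.algebraMap_toAlgebra, Localization.awayMap, IsLocalization.Away.map, Sc, Rc,
      IsScalarTower.algebraMap_apply S R (Localization.Away (algebraMap S R c))])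
  have hu : IsUnit (algebraMap S Sc c) := IsLocalization.Away.algebraMap_isUnit c
  have hgen : ∀ r : R, IsIntegral Sc (algebraMap R Rc r) := by
    intro r
    have hr : r ∈ Algebra.adjoin S (t : Set R) := ht ▸ trivial
    induction hr using Algebra.adjoin_induction with
    | mem x hx =>
      have h1 : IsIntegral Sc (algebraMap R Rc (c • x)) :=
        ((hint x hx).map (IsScalarTower.toAlgHom S R Rc)).tower_top
      have h2 := h1.smul (↑hu.unit⁻¹ : Sc)
      convert h2 using 1
      rw [eq_comm, ← Units.smul_def, inv_smul_eq_iff, Units.smul_def, IsUnit.unit_spec,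
        algebraMap_smul, Algebra.smul_def, Algebra.smul_def, map_mul,
        ← IsScalarTower.algebraMap_apply]
    | algebraMap x =>
      rw [← IsScalarTower.algebraMap_apply, IsScalarTower.algebraMap_apply S Sc Rc]
      exact isIntegral_algebraMap
    | add x y _ _ hx hy => rw [map_add]; exact hx.add hy
    | mul x y _ _ hx hy => rw [map_mul]; exact hx.mul hy
  have : Algebra.IsIntegral Sc Rc := by
    refine ⟨fun z ↦ ?_⟩
    obtain ⟨n, r, hr⟩ := IsLocalization.Away.surj (algebraMap S R c) z
    have h2 := (hgen r).smul (↑(hu.unit ^ n)⁻¹ : Sc)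
    convert h2 using 1
    rw [← hr, eq_comm, ← Units.smul_def, inv_smul_eq_iff, Units.smul_def, Algebra.smul_def,
      mul_comm, Units.val_pow_eq_pow_val, map_pow, IsUnit.unit_spec,
      ← IsScalarTower.algebraMap_apply, ← IsScalarTower.algebraMap_apply]
  have : FaithfulSMul Sc Rc := by
    rw [faithfulSMul_iff_algebraMap_injective, RingHom.algebraMap_toAlgebra,
      Localization.awayMap_injective_iff]
    intro a ha
    exact ⟨0, by simpa using ha⟩
  have hd : ∀ i, Disjoint (Submonoid.powers c : Set S) (l i).asIdeal := fun i ↦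
    (Ideal.disjoint_powers_iff_notMem c (l i).2.isRadical).mpr fun h ↦ hl (l.monotone (Fin.le_last i) h)
  let m : Fin (l.length + 1) → PrimeSpectrum Sc := fun i ↦
    ⟨(l i).asIdeal.map (algebraMap S Sc), IsLocalization.isPrime_of_isPrime_disjoint
      (Submonoid.powers c) _ _ (l i).2 (hd i)⟩
  have hm : ∀ i, (m i).comap (algebraMap S Sc) = l i := fun i ↦ PrimeSpectrum.ext <|
    IsLocalization.under_map_of_isPrime_disjoint (Submonoid.powers c) _ (l i).2 (hd i)
  have hmono : StrictMono m :=
    Monotone.strictMono_of_injective (fun i j hij ↦ Ideal.map_mono (l.monotone hij)) fun i j hij ↦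
      l.strictMono.injective (by rw [← hm i, ← hm j, hij])
  let l' : LTSeries (PrimeSpectrum Sc) := LTSeries.mk l.length m hmono
  have : IsDomain Rc := IsLocalization.isDomain_localization
    (powers_le_nonZeroDivisors_of_noZeroDivisors (by simpa using hc))
  obtain ⟨P, hP, hPo⟩ := Ideal.exists_ideal_over_prime_of_isIntegral_of_isDomain (S := Rc)
    l'.head.asIdeal (by
      rw [(RingHom.injective_iff_ker_eq_bot _).mp (FaithfulSMul.algebraMap_injective Sc Rc)]
      exact bot_le)
  have : P.LiesOver l'.head.asIdeal := ⟨hPo.symm⟩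
  obtain ⟨L, hlen, -, hL⟩ := Ideal.exists_ltSeries_of_hasGoingUp l' P
  have hlen' : l.length = L.length := hlen.symm
  refine ⟨fun i ↦ (L (i.cast (by rw [hlen']))).comap (algebraMap R Rc), fun i j hij ↦
    Ideal.comap_mono (L.monotone hij), fun i ↦ ?_⟩
  rw [← hm i]
  have h1 : (L (i.cast (by rw [hlen']))).comap (algebraMap Sc Rc) = m i := by
    have h0 := congrArg (fun k ↦ k[(i : ℕ)]?) hL
    have h2 : (i : ℕ) < L.length + 1 := hlen' ▸ i.2
    have h3 : (i : ℕ) < l'.length + 1 := i.2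
    simp only [List.getElem?_map, RelSeries.length_toList, h2, h3, getElem?_pos,
      RelSeries.toList_getElem, Option.map_some, Option.some.injEq] at h0
    exact h0
  rw [← h1, ← PrimeSpectrum.comap_comp_apply, ← PrimeSpectrum.comap_comp_apply,
    ← IsScalarTower.algebraMap_eq, ← IsScalarTower.algebraMap_eq]

/-- A chain of primes extends to a polynomial ring, avoiding a polynomial `s` if the chain avoids one
of the coefficients of `s`. -/
theorem exists_ltSeries_mvPolynomial_comap_C {T : Type*} [CommRing T] (σ : Type*)
    (l : LTSeries (PrimeSpectrum T)) (s : MvPolynomial σ T) (m : σ →₀ ℕ)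
    (hs : s.coeff m ∉ l.last.asIdeal) :
    ∃ L : LTSeries (PrimeSpectrum (MvPolynomial σ T)), L.length = l.length ∧
      s ∉ L.last.asIdeal ∧ ∀ (i : ℕ) (hi : i < L.length + 1) (hi' : i < l.length + 1),
        (L ⟨i, hi⟩).comap MvPolynomial.C = l ⟨i, hi'⟩ := by
  let e : PrimeSpectrum T → PrimeSpectrum (MvPolynomial σ T) := fun p ↦
    ⟨RingHom.ker (MvPolynomial.map (Ideal.Quotient.mk p.asIdeal)), RingHom.ker_isPrime _⟩
  have hmem : ∀ p f, f ∈ (e p).asIdeal ↔ ∀ m, f.coeff m ∈ p.asIdeal := fun p f ↦ by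
    simp [e, RingHom.mem_ker, MvPolynomial.ext_iff, MvPolynomial.coeff_map,
      Ideal.Quotient.eq_zero_iff_mem]
  have hcomap : ∀ p, (e p).comap MvPolynomial.C = p := fun p ↦ by
    ext x
    simp [e, RingHom.mem_ker, Ideal.Quotient.eq_zero_iff_mem]
  have he : StrictMono e := Monotone.strictMono_of_injective
    (fun p q hpq f hf ↦ (hmem q f).mpr fun m ↦ hpq ((hmem p f).mp hf m))
    (Function.LeftInverse.injective hcomap)
  refine ⟨l.map e he, rfl, fun h ↦ hs ?_, fun i _ _ ↦ hcomap _⟩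
  exact (hmem _ _).mp (by simpa using h) m

/-- Comparison of dimensions for `A → B → R` with `A → R` injective and `R` a domain of finite type
over a Noetherian ring `k` in which every nonzero element avoids a prime of height at least `dim k`. -/
theorem ringKrullDim_le_of_faithfulSMul_of_isDomain {k A B R : Type*} [CommRing k]
    [IsNoetherianRing k] [CommRing A] [CommRing B] [CommRing R] [IsDomain R]
    [Algebra k A] [Algebra A B] [Algebra B R] [Algebra A R] [Algebra k R]
    [IsScalarTower A B R] [IsScalarTower k A R] [FaithfulSMul k R] [FaithfulSMul A R]
    [Algebra.FiniteType k R]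
    {N : ℕ∞} (hN : ringKrullDim k ≤ N)
    (hk : ∀ s : k, s ≠ 0 → ∃ q : PrimeSpectrum k, s ∉ q.asIdeal ∧ N ≤ Order.height q) :
    ringKrullDim A ≤ ringKrullDim B := by
  refine iSup_le fun l ↦ ?_
  have hinj := FaithfulSMul.algebraMap_injective A R
  have : IsDomain A := hinj.isDomain
  have hex : ∀ i : Fin l.length, ∃ a : A, a ∈ (l i.succ).asIdeal ∧ a ∉ (l i.castSucc).asIdeal :=
    fun i ↦ Set.exists_of_ssubset (l.step i)
  choose a ha ha' using hex
  let S := Algebra.adjoin k (Set.range a)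
  have : Algebra.FiniteType k S := Algebra.FiniteType.adjoin_of_finite (Set.finite_range a)
  have : FaithfulSMul k A := by
    rw [faithfulSMul_iff_algebraMap_injective]
    have := FaithfulSMul.algebraMap_injective k R
    rw [IsScalarTower.algebraMap_eq k A R, RingHom.coe_comp] at this
    exact this.of_comp
  have : FaithfulSMul k S := by
    rw [faithfulSMul_iff_algebraMap_injective]
    exact fun x y hxy ↦ FaithfulSMul.algebraMap_injective k A (congrArg Subtype.val hxy)
  have hlS : l.length ≤ ringKrullDim S := by
    let l' : LTSeries (PrimeSpectrum S) :=
      { length := l.length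
        toFun := fun i ↦ (l i).comap S.val.toRingHom
        step := fun i ↦ by
          refine Set.ssubset_iff_exists.mpr
            ⟨fun x hx ↦ (show l i.castSucc < l i.succ from l.step i).le hx,
            ⟨a i, Algebra.subset_adjoin ⟨i, rfl⟩⟩, ha i, ha' i⟩ }
    exact Order.LTSeries.length_le_krullDim l'
  obtain ⟨d, f, hf, halg⟩ := exists_injective_mvPolynomial_isAlgebraic k S
  have hdim : ringKrullDim S ≤ ringKrullDim k + d := by
    let : Algebra (MvPolynomial (Fin d) k) S := f.toRingHom.toAlgebra
    have : IsScalarTower k (MvPolynomial (Fin d) k) S :=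
      IsScalarTower.of_algebraMap_eq fun x ↦ (f.commutes x).symm
    have : FaithfulSMul (MvPolynomial (Fin d) k) S :=
      (faithfulSMul_iff_algebraMap_injective _ _).mpr hf
    have : Algebra.FiniteType (MvPolynomial (Fin d) k) S :=
      .of_restrictScalars_finiteType k _ _
    refine (ringKrullDim_le_of_isAlgebraic_of_finiteType (MvPolynomial (Fin d) k) S).trans ?_
    rw [MvPolynomial.ringKrullDim_of_isNoetherianRing]
    simp
  let φ : MvPolynomial (Fin d) k →+* B := (algebraMap A B).comp (S.val.toRingHom.comp f.toRingHom)
  let : Algebra (MvPolynomial (Fin d) k) R := ((algebraMap B R).comp φ).toAlgebra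
  have hφ : algebraMap (MvPolynomial (Fin d) k) R = (algebraMap B R).comp φ := rfl
  have hφ' : ∀ x, algebraMap (MvPolynomial (Fin d) k) R x = algebraMap A R (f x : A) := fun x ↦
    (IsScalarTower.algebraMap_apply A B R (f x : A)).symm
  have : IsScalarTower k (MvPolynomial (Fin d) k) R := IsScalarTower.of_algebraMap_eq fun x ↦ by
    rw [hφ', f.commutes,
      IsScalarTower.algebraMap_apply k A R]
    rfl
  have : FaithfulSMul (MvPolynomial (Fin d) k) R := by
    rw [faithfulSMul_iff_algebraMap_injective]
    intro x y hxy
    rw [hφ', hφ'] at hxy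
    exact hf (Subtype.ext (hinj hxy))
  have : Algebra.FiniteType (MvPolynomial (Fin d) k) R := .of_restrictScalars_finiteType k _ _
  obtain ⟨e, g, hg, hgalg⟩ := exists_injective_mvPolynomial_isAlgebraic (MvPolynomial (Fin d) k) R
  let : Algebra (MvPolynomial (Fin e) (MvPolynomial (Fin d) k)) R := g.toRingHom.toAlgebra
  have : IsScalarTower (MvPolynomial (Fin d) k) (MvPolynomial (Fin e) (MvPolynomial (Fin d) k)) R :=
    IsScalarTower.of_algebraMap_eq fun x ↦ (g.commutes x).symm
  have : FaithfulSMul (MvPolynomial (Fin e) (MvPolynomial (Fin d) k)) R :=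
    (faithfulSMul_iff_algebraMap_injective _ _).mpr hg
  have : Algebra.FiniteType (MvPolynomial (Fin e) (MvPolynomial (Fin d) k)) R :=
    .of_restrictScalars_finiteType (MvPolynomial (Fin d) k) _ _
  obtain ⟨s, hs, hlift⟩ :=
    exists_forall_ltSeries_lift_of_isAlgebraic (MvPolynomial (Fin e) (MvPolynomial (Fin d) k)) R
  obtain ⟨m, hm⟩ := MvPolynomial.ne_zero_iff.mp hs
  obtain ⟨q, hq, hqN⟩ := exists_notMem_height_mvPolynomial hk d _ hm
  have hlq : (l.length : ℕ∞) ≤ Order.height q := by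
    refine le_trans ?_ hqN
    have := hlS.trans (hdim.trans (add_le_add_left hN _))
    exact_mod_cast this
  obtain ⟨l₁, hl₁, hlen₁⟩ := Order.exists_series_of_le_height q hlq
  obtain ⟨l₂, hlen₂, hs₂, hl₂⟩ := exists_ltSeries_mvPolynomial_comap_C (Fin e) l₁ s m (hl₁ ▸ hq)
  obtain ⟨L, hL, hLl⟩ := hlift l₂ hs₂
  let L' : Fin (l₂.length + 1) → PrimeSpectrum B := fun i ↦ (L i).comap (algebraMap B R)
  have hL' : ∀ i, (L' i).comap φ = l₁ ⟨i, hlen₂ ▸ i.2⟩ := fun i ↦ by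
    rw [← hl₂ i i.2, ← hLl, ← PrimeSpectrum.comap_comp_apply, ← PrimeSpectrum.comap_comp_apply,
      ← hφ, ← MvPolynomial.algebraMap_eq, ← IsScalarTower.algebraMap_eq]
  have hmono : StrictMono L' := Monotone.strictMono_of_injective
    (fun i j hij ↦ Ideal.comap_mono (hL hij)) fun i j hij ↦ by
      have := l₁.strictMono.injective ((hL' i).symm.trans ((congrArg _ hij).trans (hL' j)))
      exact Fin.ext (Fin.mk.inj this)
  rw [← hlen₁, ← hlen₂]
  exact Order.LTSeries.length_le_krullDim (LTSeries.mk _ L' hmono)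

theorem Int.exists_notMem_one_le_height (s : ℤ) (hs : s ≠ 0) :
    ∃ q : PrimeSpectrum ℤ, s ∉ q.asIdeal ∧ 1 ≤ Order.height q := by
  obtain ⟨p, hp, hprime⟩ := Nat.exists_infinite_primes (s.natAbs + 1)
  have hp' := Nat.prime_iff_prime_int.mp hprime
  refine ⟨⟨Ideal.span {(p : ℤ)}, (Ideal.span_singleton_prime hp'.ne_zero).mpr hp'⟩, ?_, ?_⟩
  · rw [Ideal.mem_span_singleton]
    intro h
    have := Nat.le_of_dvd (Int.natAbs_pos.mpr hs) (Int.natCast_dvd.mp h)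
    lia
  · rw [Order.one_le_iff_pos, Order.height_pos, isMin_iff_eq_bot]
    intro h
    have := congrArg PrimeSpectrum.asIdeal h
    simp [hprime.ne_zero] at this

theorem ringKrullDim_le_of_isDomain {A B R : Type*} [CommRing A] [CommRing B] [CommRing R]
    [IsDomain R] [Algebra.FiniteType ℤ R] (f : A →+* B) (g : B →+* R)
    (hfg : Function.Injective (g.comp f)) :
    ringKrullDim A ≤ ringKrullDim B := by
  let := f.toAlgebra
  let := g.toAlgebra
  let := (g.comp f).toAlgebra
  have : IsScalarTower A B R := IsScalarTower.of_algebraMap_eq' rfl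
  have : FaithfulSMul A R := (faithfulSMul_iff_algebraMap_injective _ _).mpr hfg
  obtain ⟨p, hp⟩ := CharP.exists R
  rcases CharP.char_is_prime_or_zero R p with hprime | rfl
  · have := Fact.mk hprime
    have : CharP A p := (RingHom.charP_iff (g.comp f) hfg p).mpr hp
    let := ZMod.algebra A p
    let := ZMod.algebra R p
    have : Algebra.FiniteType (ZMod p) R := .of_restrictScalars_finiteType ℤ _ _
    have : IsScalarTower (ZMod p) A R := IsScalarTower.of_algebraMap_eq' (Subsingleton.elim _ _)
    refine ringKrullDim_le_of_faithfulSMul_of_isDomain (k := ZMod p) (R := R) (N := 0) (by simp)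
      fun s hs ↦ ⟨⊥, by simpa using hs, zero_le⟩
  · have := CharP.charP_to_charZero R
    refine ringKrullDim_le_of_faithfulSMul_of_isDomain (k := ℤ) (R := R) (N := 1) ?_
      Int.exists_notMem_one_le_height
    rw [IsPrincipalIdealRing.ringKrullDim_eq_one ℤ Int.not_isField]
    rfl

/-- If `R` is of finite type over `ℤ` and `A → B → R` has injective composition, then
`dim A ≤ dim B`. -/
theorem ringKrullDim_le_of_injective_of_finiteType {A B R : Type*} [CommRing A] [CommRing B]
    [CommRing R] [Algebra.FiniteType ℤ R] (f : A →+* B) (g : B →+* R)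
    (hfg : Function.Injective (g.comp f)) :
    ringKrullDim A ≤ ringKrullDim B := by
  refine iSup_le fun l ↦ ?_
  obtain ⟨p, hp, hpl⟩ := Ideal.exists_minimalPrimes_le (J := l.head.asIdeal) bot_le
  obtain ⟨M, hM, hMp⟩ := Ideal.exists_comap_eq_of_mem_minimalPrimes_of_injective hfg p hp
  have hl : l.length ≤ ringKrullDim (A ⧸ p) := by
    rw [ringKrullDim_quotient]
    exact Order.LTSeries.length_le_krullDim (LTSeries.mk l.length
      (fun i ↦ (⟨l i, hpl.trans (l.monotone (Fin.zero_le i))⟩ :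
      PrimeSpectrum.zeroLocus (p : Set A))) fun i j hij ↦ l.strictMono hij)
  refine hl.trans (le_trans ?_ (ringKrullDim_quotient_le (M.comap g)))
  have : @Algebra.FiniteType ℤ (R ⧸ M) _ _ (Ring.toIntAlgebra _) :=
    .of_surjective (Ideal.Quotient.mk M).toIntAlgHom Ideal.Quotient.mk_surjective
  refine ringKrullDim_le_of_isDomain (R := R ⧸ M)
    (Ideal.quotientMap (I := p) (M.comap g) f (by rw [← hMp, Ideal.comap_comap]))
    (Ideal.quotientMap M g le_rfl) ?_
  rw [injective_iff_map_eq_zero]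
  intro x hx
  obtain ⟨x, rfl⟩ := Ideal.Quotient.mk_surjective x
  rw [Ideal.Quotient.eq_zero_iff_mem, ← hMp]
  simpa [Ideal.Quotient.eq_zero_iff_mem] using hx

/-- If `R` is finitely generated as a `ℤ`-algebra, `G` a group of automorphisms
of `R` and `H ⊆ G` a subgroup, then `dim (R^G) ≤ dim (R^H)`. -/
theorem ringKrullDim_fixed_le_of_subgroup {R : Type*} [CommRing R]
    [Algebra.FiniteType ℤ R] (G H : Subgroup (RingAut R)) (hHG : H ≤ G) :
    ringKrullDim (fixedSubring R G) ≤ ringKrullDim (fixedSubring R H) := by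
  have hle : fixedSubring R G ≤ fixedSubring R H := fun _ hx g hg ↦ hx g (hHG hg)
  exact ringKrullDim_le_of_injective_of_finiteType (Subring.inclusion hle)
    (fixedSubring R H).subtype Subtype.val_injective
end

section
/- Let A be a finitely generated algebra over a field K that is an integral domain, and let a ∈ A be nonzero. Then dim(A[a^{-1}]) = dim(A), where A[a^{-1}] is the localization of A at the powers of a. -/
/-- The Krull dimension is invariant under injective integral extensions. -/
theorem ringKrullDim_eq_of_isIntegral_of_faithfulSMul (R S : Type*) [CommRing R] [CommRing S]
    [Algebra R S] [Algebra.IsIntegral R S] [FaithfulSMul R S] :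
    ringKrullDim S = ringKrullDim R := by
  apply le_antisymm
  · exact Order.krullDim_le_of_strictMono (PrimeSpectrum.comap (algebraMap R S))
      fun _ _ h ↦ Ideal.IsIntegral.comap_lt_comap h
  · refine iSup_le fun l ↦ ?_
    obtain ⟨⟨P, hP, hPl⟩⟩ : Nonempty (l.head.asIdeal.primesOver S) := inferInstance
    obtain ⟨L, hL, -⟩ := Ideal.exists_ltSeries_of_hasGoingUp l P
    exact hL ▸ Order.LTSeries.length_le_krullDim L

/-- The Krull dimension of a finitely generated domain over a field is its transcendence degree. -/
theorem ringKrullDim_eq_trdeg_of_finiteType (K A : Type*) [Field K] [CommRing A] [IsDomain A]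
    [Algebra K A] [Algebra.FiniteType K A] :
    ringKrullDim A = (Algebra.trdeg K A).toNat := by
  obtain ⟨s, g, hinj, hint⟩ := exists_integral_inj_algHom_of_fg K A
  algebraize [g.toRingHom]
  have : FaithfulSMul (MvPolynomial (Fin s) K) A :=
    (faithfulSMul_iff_algebraMap_injective _ _).mpr hinj
  have htr := lift_trdeg_add_eq K (MvPolynomial (Fin s) K) A
  rw [trdeg_eq_zero (A := A), MvPolynomial.trdeg_of_isDomain] at htr
  have hs : (Algebra.trdeg K A).toNat = s := by
    simpa using (congrArg Cardinal.toNat htr).symm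
  rw [ringKrullDim_eq_of_isIntegral_of_faithfulSMul (MvPolynomial (Fin s) K) A,
    MvPolynomial.ringKrullDim_of_isNoetherianRing, ringKrullDim_eq_zero_of_field, hs]
  simp

/-- If `A` is a finitely generated domain over a field `K` and `a ∈ A` is
nonzero, then `dim A[a⁻¹] = dim A`. -/
theorem ringKrullDim_away_eq {K A : Type*} [Field K] [CommRing A] [IsDomain A]
    [Algebra K A] [Algebra.FiniteType K A] (a : A) (ha : a ≠ 0) :
    ringKrullDim (Localization.Away a) = ringKrullDim A := by
  have hle : Submonoid.powers a ≤ nonZeroDivisors A :=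
    powers_le_nonZeroDivisors_of_noZeroDivisors ha
  have : IsDomain (Localization.Away a) := IsLocalization.isDomain_localization hle
  have : FaithfulSMul A (Localization.Away a) :=
    (faithfulSMul_iff_algebraMap_injective _ _).mpr (IsLocalization.injective _ hle)
  have : Algebra.FiniteType A (Localization.Away a) := IsLocalization.finiteType_of_monoid_fg
    (Submonoid.powers a) _
  have : Algebra.FiniteType K (Localization.Away a) := .trans (S := A) ‹_› ‹_›
  have : Algebra.IsAlgebraic A (Localization.Away a) :=
    IsLocalization.isAlgebraic _ (Submonoid.powers a)
  rw [ringKrullDim_eq_trdeg_of_finiteType K, ringKrullDim_eq_trdeg_of_finiteType K A,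
    ← trdeg_add_eq K A (A := Localization.Away a), trdeg_eq_zero (R := A), add_zero]
end
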